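/- Let T be a tree on the vertex set {1,…,n} with n ≥ 2. Then every n-cycle of {1,…,n} arises as the product of some edge ordering of T (equivalently, |C(T)| = (n−1)!) if and only if T is a star, i.e., some vertex of T is adjacent to all other vertices. (Corollary 2.4(a).) -/

import Mathlib

/-- The transposition of `Sₙ` corresponding to an edge (an unordered pair) of a graph
on the vertex set `Fin n`. -/
def edgePerm {n : ℕ} (e : Sym2 (Fin n)) : Equiv.Perm (Fin n) :=
  Sym2.lift ⟨fun i j => Equiv.swap i j, fun i j => Equiv.swap_comm i j⟩ e

/-- The product of the transpositions of a list of edges, the first edge applied first. -/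
def listProd {n : ℕ} (l : List (Sym2 (Fin n))) : Equiv.Perm (Fin n) :=
  (l.map edgePerm).reverse.prod

/-- `l` is an edge ordering of the graph `T`: a duplicate-free list containing
exactly the edges of `T`. -/
def IsEdgeOrdering {n : ℕ} (T : SimpleGraph (Fin n)) (l : List (Sym2 (Fin n))) : Prop :=
  l.Nodup ∧ ∀ e, e ∈ l ↔ e ∈ T.edgeSet

theorem edgePerm_map {n : ℕ} (σ : Equiv.Perm (Fin n)) (e : Sym2 (Fin n)) :
    edgePerm (e.map σ) = σ * edgePerm e * σ⁻¹ := by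
  induction e using Sym2.ind with
  | _ x y => exact Equiv.swap_apply_apply σ x y

theorem listProd_cons {n : ℕ} (e : Sym2 (Fin n)) (l : List (Sym2 (Fin n))) :
    listProd (e :: l) = listProd l * edgePerm e := by
  simp [listProd]

theorem listProd_append {n : ℕ} (l₁ l₂ : List (Sym2 (Fin n))) :
    listProd (l₁ ++ l₂) = listProd l₂ * listProd l₁ := by
  simp [listProd]

theorem listProd_map {n : ℕ} (σ : Equiv.Perm (Fin n)) (l : List (Sym2 (Fin n))) :
    listProd (l.map (Sym2.map σ)) = σ * listProd l * σ⁻¹ := by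
  induction l with
  | nil => simp [listProd]
  | cons e l ih => rw [List.map_cons, listProd_cons, listProd_cons, ih, edgePerm_map]; group

/-- An edge of the list can be moved to the front at the cost of conjugating the edges before it. -/
theorem exists_listProd_eq_mul_edgePerm {n : ℕ} (l₁ l₂ : List (Sym2 (Fin n)))
    (e : Sym2 (Fin n)) : ∃ l₁' : List (Sym2 (Fin n)), l₁'.length = l₁.length ∧
      listProd (l₁ ++ e :: l₂) = listProd (l₁' ++ l₂) * edgePerm e := by
  refine ⟨l₁.map (Sym2.map (edgePerm e)), by simp, ?_⟩
  rw [listProd_append, listProd_append, listProd_cons, listProd_map]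
  group

theorem exists_listProd_eq_mul_mul {n : ℕ} {l : List (Sym2 (Fin n))} {e f : Sym2 (Fin n)}
    (he : e ∈ l) (hf : f ∈ l) (hne : e ≠ f) (hcomm : Commute (edgePerm e) (edgePerm f)) :
    ∃ l' : List (Sym2 (Fin n)), l'.length + 2 = l.length ∧
      listProd l = listProd l' * (edgePerm e * edgePerm f) := by
  obtain ⟨l₁, l₂, rfl⟩ := List.append_of_mem he
  obtain ⟨l₁', hlen, hprod⟩ := exists_listProd_eq_mul_edgePerm l₁ l₂ e
  rcases List.mem_append.1 hf with h | h
  · obtain ⟨A, B, rfl⟩ := List.append_of_mem h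
    obtain ⟨A', hA, hA'⟩ := exists_listProd_eq_mul_edgePerm A (B ++ e :: l₂) f
    obtain ⟨C, hC, hC'⟩ := exists_listProd_eq_mul_edgePerm (A' ++ B) l₂ e
    refine ⟨C ++ l₂, by simp at hC ⊢; omega, ?_⟩
    rw [← mul_assoc, ← hC']
    simpa using hA'
  · obtain ⟨A, B, rfl⟩ := List.append_of_mem ((List.mem_cons.1 h).resolve_left hne.symm)
    obtain ⟨C, hC, hC'⟩ := exists_listProd_eq_mul_edgePerm (l₁' ++ A) B f
    refine ⟨C ++ B, by simp at hC ⊢; omega, ?_⟩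
    rw [hcomm.eq, ← mul_assoc, ← hC', hprod]
    simp

theorem reachable_listProd {n : ℕ} (G : SimpleGraph (Fin n)) (l : List (Sym2 (Fin n)))
    (hl : ∀ e ∈ l, ¬ e.IsDiag → e ∈ G.edgeSet) (x : Fin n) : G.Reachable x (listProd l x) := by
  induction l generalizing x with
  | nil => exact SimpleGraph.Reachable.refl _
  | cons e l ih =>
    rw [listProd_cons, Equiv.Perm.mul_apply]
    refine SimpleGraph.Reachable.trans ?_ (ih (fun e he => hl e (List.mem_cons_of_mem _ he)) _)
    have he := hl e List.mem_cons_self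
    induction e using Sym2.ind with
    | _ a b =>
      change G.Reachable x (Equiv.swap a b x)
      by_cases hab : a = b
      · simp [hab]
      · have hadj : G.Adj a b := he hab
        rw [Equiv.swap_apply_def]
        split_ifs with h₁ h₂
        · exact h₁ ▸ hadj.reachable
        · exact h₂ ▸ hadj.symm.reachable
        · rfl

/-- A full cycle on `n` points is not a product of fewer than `n - 1` transpositions. -/
theorem le_length_add_one_of_isCycle_listProd {n : ℕ} {l : List (Sym2 (Fin n))}
    (hc : (listProd l).IsCycle) (hfix : ∀ x, listProd l x ≠ x) : n ≤ l.length + 1 := by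
  classical
  let G : SimpleGraph (Fin n) := SimpleGraph.fromEdgeSet {e | e ∈ l}
  have hreach (x : Fin n) : G.Reachable x (listProd l x) :=
    reachable_listProd G l (fun e he hd => by simpa [G] using ⟨he, hd⟩) x
  have hpow (x : Fin n) (i : ℕ) : G.Reachable x ((listProd l ^ i) x) := by
    induction i with
    | zero => simp
    | succ i ih =>
      rw [pow_succ', Equiv.Perm.mul_apply]
      exact ih.trans (hreach _)
  obtain ⟨x₀, -⟩ := id hc
  have hconn : G.Connected := by
    have : Nonempty (Fin n) := ⟨x₀⟩
    refine ⟨fun x y => ?_⟩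
    obtain ⟨i, rfl⟩ := hc.exists_pow_eq (hfix x) (hfix y)
    exact hpow x i
  have hcard := hconn.card_vert_le_card_edgeSet_add_one
  have hsub : G.edgeSet ⊆ (l.toFinset : Set (Sym2 (Fin n))) := fun e he => by
    simp only [G, SimpleGraph.edgeSet_fromEdgeSet] at he
    simpa using he.1
  have hle : Nat.card G.edgeSet ≤ l.length := by
    rw [Nat.card_coe_set_eq]
    refine (Set.ncard_le_ncard hsub (Finset.finite_toSet _)).trans ?_
    rw [Set.ncard_coe_finset]
    exact l.toFinset_card_le
  simp at hcard hle
  omega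

theorem List.formPerm_cons_cons_eq_mul_swap {α : Type*} [DecidableEq α] (v y : α) (l : List α)
    (hl : (v :: y :: l).Nodup) :
    (v :: y :: l).formPerm = (v :: l).formPerm * Equiv.swap v y := by
  cases l with
  | nil => simp
  | cons z l =>
    simp only [List.nodup_cons, List.mem_cons, not_or] at hl
    obtain ⟨⟨hvy, hvz, hvl⟩, ⟨hyz, hyl⟩, -⟩ := hl
    have hv : (z :: l).formPerm v = v := List.formPerm_apply_of_notMem (by simp [hvz, hvl])
    have hy : (z :: l).formPerm y = y := List.formPerm_apply_of_notMem (by simp [hyz, hyl])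
    have hcomm := Equiv.mul_swap_eq_swap_mul (z :: l).formPerm v y
    rw [hv, hy] at hcomm
    have hswap : Equiv.swap v y * Equiv.swap y z = Equiv.swap v z * Equiv.swap v y := by
      ext x
      simp only [Equiv.Perm.mul_apply, Equiv.swap_apply_def]
      grind
    rw [List.formPerm_cons_cons, List.formPerm_cons_cons, List.formPerm_cons_cons, mul_assoc,
      hcomm, ← mul_assoc, ← mul_assoc, hswap]

theorem listProd_star {n : ℕ} (v : Fin n) (l : List (Fin n)) (hl : (v :: l).Nodup) :
    listProd (l.map fun w => s(v, w)) = (v :: l).formPerm := by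
  induction l with
  | nil => simp [listProd]
  | cons y l ih =>
    rw [List.map_cons, listProd_cons, List.formPerm_cons_cons_eq_mul_swap v y l hl,
      ih (hl.sublist (by simp))]
    rfl

theorem formPerm_crossing_mul_swap_mul_swap {α : Type*} [DecidableEq α] (a b c d : α)
    (l : List α) (hl : (a :: c :: b :: d :: l).Nodup) :
    (a :: c :: b :: d :: l).formPerm * (Equiv.swap a b * Equiv.swap c d) =
      (a :: d :: b :: c :: l).formPerm := by
  have hl' : (a :: d :: b :: c :: l).Nodup := by
    simp only [List.nodup_cons, List.mem_cons] at hl ⊢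
    grind
  rw [List.formPerm_cons_cons_eq_mul_swap _ _ _ hl,
    List.formPerm_cons_cons_eq_mul_swap _ _ _ (hl.sublist (by simp)),
    List.formPerm_cons_cons_eq_mul_swap _ _ _ (hl.sublist (by simp)),
    List.formPerm_cons_cons_eq_mul_swap _ _ _ hl',
    List.formPerm_cons_cons_eq_mul_swap _ _ _ (hl'.sublist (by simp)),
    List.formPerm_cons_cons_eq_mul_swap _ _ _ (hl'.sublist (by simp))]
  simp only [mul_assoc]
  congr 1
  simp only [List.nodup_cons, List.mem_cons] at hl
  ext x
  simp only [Equiv.Perm.mul_apply, Equiv.swap_apply_def]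
  grind

theorem formPerm_isCycle_of_forall_mem {α : Type*} [DecidableEq α] {a b : α} {l : List α}
    (hl : (a :: b :: l).Nodup) (hmem : ∀ x, x ∈ a :: b :: l) :
    (a :: b :: l).formPerm.IsCycle ∧ ∀ x, (a :: b :: l).formPerm x ≠ x :=
  ⟨List.isCycle_formPerm hl (by simp),
    fun x => (List.formPerm_apply_mem_ne_self_iff _ hl x (hmem x)).2 (by simp)⟩

theorem IsEdgeOrdering.length_add_one {n : ℕ} {T : SimpleGraph (Fin n)} (hT : T.IsTree)
    {l : List (Sym2 (Fin n))} (hl : IsEdgeOrdering T l) : l.length + 1 = n := by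
  classical
  have hset : l.toFinset = T.edgeFinset := by
    ext e
    simp [hl.2 e]
  rw [← List.toFinset_card_of_nodup hl.1, hset, hT.card_edgeFinset, Fintype.card_fin]

/-- A connected graph in which no vertex is adjacent to all others has two disjoint edges. -/
theorem SimpleGraph.Connected.exists_disjoint_edges {V : Type*} [Nontrivial V]
    {G : SimpleGraph V} (hG : G.Connected) (hstar : ¬ ∃ v, ∀ w, w ≠ v → G.Adj v w) :
    ∃ a b c d, G.Adj a b ∧ G.Adj c d ∧ a ≠ c ∧ a ≠ d ∧ b ≠ c ∧ b ≠ d := by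
  by_contra! hdisj
  push Not at hstar
  obtain ⟨a⟩ := hG.nonempty
  obtain ⟨b, hab⟩ := hG.preconnected.exists_adj_of_nontrivial a
  obtain ⟨w, hwa, hw⟩ := hstar a
  obtain ⟨u, hub, hu⟩ := hstar b
  obtain ⟨x, hwx⟩ := hG.preconnected.exists_adj_of_nontrivial w
  obtain ⟨y, huy⟩ := hG.preconnected.exists_adj_of_nontrivial u
  have hwb : w ≠ b := by rintro rfl; exact hw hab
  have hua : u ≠ a := by rintro rfl; exact hu hab.symm
  have hxa : x ≠ a := by rintro rfl; exact hw hwx.symm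
  have hyb : y ≠ b := by rintro rfl; exact hu huy.symm
  obtain rfl : b = x := hdisj a b w x hab hwx hwa.symm hxa.symm hwb.symm
  obtain rfl : a = y := hdisj b a u y hab.symm huy hub.symm hyb.symm hua.symm
  have hwu : w ≠ u := by rintro rfl; exact hw huy.symm
  exact hab.ne' (hdisj w b u a hwx huy hwu hwa hub.symm)

theorem not_exists_listProd_eq_crossing {n : ℕ} {T : SimpleGraph (Fin n)} (hT : T.IsTree)
    {a b c d : Fin n} {l : List (Fin n)} (hab : T.Adj a b) (hcd : T.Adj c d)
    (hl : (a :: c :: b :: d :: l).Nodup) (hmem : ∀ x, x ∈ a :: c :: b :: d :: l) :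
    ¬ ∃ L, IsEdgeOrdering T L ∧ listProd L = (a :: c :: b :: d :: l).formPerm := by
  rintro ⟨L, hL, hprod⟩
  have hne : a ≠ c ∧ a ≠ d ∧ b ≠ c ∧ b ≠ d := by
    simp only [List.nodup_cons, List.mem_cons] at hl
    grind
  have hcomm : Equiv.swap a b * Equiv.swap c d = Equiv.swap c d * Equiv.swap a b := by
    ext x
    simp only [Equiv.Perm.mul_apply, Equiv.swap_apply_def]
    grind
  obtain ⟨L', hlen, hL'⟩ := exists_listProd_eq_mul_mul ((hL.2 s(a, b)).2 hab)
    ((hL.2 s(c, d)).2 hcd) (by simp [hne]) hcomm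
  have hprod' : listProd L' = (a :: d :: b :: c :: l).formPerm := by
    rw [← formPerm_crossing_mul_swap_mul_swap a b c d l hl, ← hprod, hL', mul_assoc]
    change _ = listProd L' * (Equiv.swap a b * Equiv.swap c d * (Equiv.swap a b * Equiv.swap c d))
    nth_rewrite 2 [hcomm]
    simp [mul_assoc]
  have hl' : (a :: d :: b :: c :: l).Nodup := by
    simp only [List.nodup_cons, List.mem_cons] at hl ⊢
    grind
  obtain ⟨hcyc, hfix⟩ := formPerm_isCycle_of_forall_mem hl' fun x => by
    have := hmem x
    simp only [List.mem_cons] at this ⊢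
    tauto
  have := le_length_add_one_of_isCycle_listProd (hprod' ▸ hcyc) (hprod' ▸ hfix)
  have := hL.length_add_one hT
  omega

theorem exists_isEdgeOrdering_of_star {n : ℕ} {T : SimpleGraph (Fin n)} (hT : T.IsTree)
    {v : Fin n} (hv : ∀ w, w ≠ v → T.Adj v w) {c : Equiv.Perm (Fin n)} (hc : c.IsCycle)
    (hfix : ∀ x, c x ≠ x) : ∃ l, IsEdgeOrdering T l ∧ listProd l = c := by
  classical
  obtain ⟨t, ht, hprod, hmem⟩ : ∃ t : List (Fin n), (v :: t).Nodup ∧ (v :: t).formPerm = c ∧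
      ∀ x, x ∈ v :: t := by
    have hcons : c.toList v = v :: (c.toList v).tail := by
      have hne : c.toList v ≠ [] := by simpa [Equiv.Perm.toList_eq_nil_iff] using hfix v
      conv_lhs => rw [← List.cons_head_tail hne]
      congr 1
      rw [List.head_eq_getElem, Equiv.Perm.getElem_toList]
      simp
    refine ⟨(c.toList v).tail, ?_, ?_, fun x => ?_⟩ <;> rw [← hcons]
    · exact Equiv.Perm.nodup_toList c v
    · rw [Equiv.Perm.formPerm_toList, hc.cycleOf_eq (hfix v)]
    · exact Equiv.Perm.mem_toList_iff.2 ⟨hc.sameCycle (hfix v) (hfix x), by simpa using hfix v⟩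
  have hnodup : (t.map fun w => s(v, w)).Nodup :=
    ht.of_cons.map fun _ _ => Sym2.congr_right.1
  refine ⟨t.map fun w => s(v, w), ⟨hnodup, ?_⟩, (listProd_star v t ht).trans hprod⟩
  have hlen : (v :: t).length = n := by
    rw [← List.toFinset_card_of_nodup ht,
      (v :: t).toFinset.eq_univ_iff_forall.2 (by simpa using hmem)]
    simp
  have hset : (t.map fun w => s(v, w)).toFinset = T.edgeFinset := by
    refine Finset.eq_of_subset_of_card_le (fun e he => ?_) ?_
    · simp only [List.mem_toFinset, List.mem_map] at he
      obtain ⟨w, hw, rfl⟩ := he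
      simpa using hv w (by rintro rfl; exact (List.nodup_cons.1 ht).1 hw)
    · have := hT.card_edgeFinset
      rw [List.toFinset_card_of_nodup hnodup]
      simp at this hlen ⊢
      omega
  intro e
  rw [← List.mem_toFinset, hset, SimpleGraph.mem_edgeFinset]

/-- Corollary 2.4(a): every `n`-cycle arises as the product of some edge
ordering of the tree `T` if and only if `T` is a star. -/
theorem stmt3 (n : ℕ) (hn : 2 ≤ n) (T : SimpleGraph (Fin n)) (hT : T.IsTree) :
    (∀ c : Equiv.Perm (Fin n), c.IsCycle → (∀ x, c x ≠ x) →
        ∃ l, IsEdgeOrdering T l ∧ listProd l = c)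
      ↔ ∃ v : Fin n, ∀ w : Fin n, w ≠ v → T.Adj v w := by
  constructor
  · intro h
    by_contra hstar
    have : Nontrivial (Fin n) := Fin.nontrivial_iff_two_le.2 hn
    obtain ⟨a, b, c, d, hab, hcd, hac, had, hbc, hbd⟩ :=
      hT.connected.exists_disjoint_edges hstar
    let l := (Finset.univ \ {a, b, c, d} : Finset (Fin n)).toList
    have hl : (a :: c :: b :: d :: l).Nodup := by
      have := hab.ne
      have := hcd.ne
      simp only [List.nodup_cons, List.mem_cons, l, Finset.mem_toList, Finset.mem_sdiff,
        Finset.mem_insert, Finset.mem_singleton, Finset.nodup_toList]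
      grind
    have hmem (x : Fin n) : x ∈ a :: c :: b :: d :: l := by
      simp only [List.mem_cons, l, Finset.mem_toList, Finset.mem_sdiff, Finset.mem_univ,
        Finset.mem_insert, Finset.mem_singleton]
      tauto
    obtain ⟨hcyc, hfix⟩ := formPerm_isCycle_of_forall_mem hl hmem
    exact not_exists_listProd_eq_crossing hT hab hcd hl hmem (h _ hcyc hfix)
  · rintro ⟨v, hv⟩ c hc hfix
    exact exists_isEdgeOrdering_of_star hT hv hc hfix
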